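/- Let ρ_t : ℛ_t^∞ → L^∞_t be a conditional convex risk measure for processes, extended to ℛ^∞ by ρ_t(X) := ρ_t(π_t(X)). Define ρ̄_t on bounded ℱ̄-measurable functions by ρ̄_t(X)(ω,s) := −X_s(ω) for s < t and ρ̄_t(X)(ω,s) := ρ_t(X)(ω) for s ≥ t. Then ρ̄_t maps bounded ℱ̄-measurable functions to bounded ℱ̄_t-measurable functions and is a conditional convex risk measure for random variables with respect to (ℱ̄_t, P̄); that is, for all bounded ℱ̄-measurable X, Y: ρ̄_t(X + m) = ρ̄_t(X) − m P̄-a.s. for every bounded ℱ̄_t-measurable m; ρ̄_t(X) ≥ ρ̄_t(Y) P̄-a.s. whenever X ≤ Y P̄-a.e.; ρ̄_t(λX + (1−λ)Y) ≤ λρ̄_t(X) + (1−λ)ρ̄_t(Y) P̄-a.s. for every ℱ̄_t-measurable λ with 0 ≤ λ ≤ 1; and ρ̄_t(0) = 0 P̄-a.s. -/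

import Mathlib

open MeasureTheory Filter

variable {Ω : Type*}

/-- Bounded measurable real-valued functions with respect to a σ-algebra (the space `L^∞`). -/
def BddMeas {α : Type*} (mm : MeasurableSpace α) (f : α → ℝ) : Prop :=
  Measurable[mm] f ∧ ∃ C : ℝ, ∀ x, |f x| ≤ C

/-- The space `ℛ^∞` of bounded adapted processes. -/
def MemRinf {m : MeasurableSpace Ω} (F : Filtration ℕ m) (X : ℕ → Ω → ℝ) : Prop :=
  (∀ s, Measurable[F s] (X s)) ∧ ∃ C : ℝ, ∀ s ω, |X s ω| ≤ C

/-- The projection `π_t` killing a process strictly before time `t`. -/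
def projt (t : ℕ) (X : ℕ → Ω → ℝ) : ℕ → Ω → ℝ := fun r ω => if t ≤ r then X r ω else 0

/-- Membership in `ℛ_t^∞ = π_t(ℛ^∞)`: bounded adapted processes vanishing before `t`. -/
def MemRt {m : MeasurableSpace Ω} (F : Filtration ℕ m) (t : ℕ) (X : ℕ → Ω → ℝ) : Prop :=
  MemRinf F X ∧ ∀ r < t, ∀ ω, X r ω = 0

/-- A conditional convex risk measure for processes at time `t`. -/
structure IsCondRiskMeasure {m : MeasurableSpace Ω} (F : Filtration ℕ m) (P : Measure Ω)
    (t : ℕ) (ρ : (ℕ → Ω → ℝ) → Ω → ℝ) : Prop where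
  map_into : ∀ X, MemRt F t X → BddMeas (F t) (ρ X)
  cash : ∀ X, MemRt F t X → ∀ mf : Ω → ℝ, BddMeas (F t) mf →
    ρ (fun r ω => X r ω + if t ≤ r then mf ω else 0) =ᵐ[P] fun ω => ρ X ω - mf ω
  mono : ∀ X Y, MemRt F t X → MemRt F t Y → (∀ s, ∀ᵐ ω ∂P, X s ω ≤ Y s ω) →
    ∀ᵐ ω ∂P, ρ Y ω ≤ ρ X ω
  convex : ∀ X Y, MemRt F t X → MemRt F t Y → ∀ lam : Ω → ℝ,
    Measurable[F t] lam → (∀ ω, 0 ≤ lam ω ∧ lam ω ≤ 1) →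
    ∀ᵐ ω ∂P, ρ (fun r ω => lam ω * X r ω + (1 - lam ω) * Y r ω) ω ≤
      lam ω * ρ X ω + (1 - lam ω) * ρ Y ω
  norm : ρ (fun _ _ => 0) =ᵐ[P] (0 : Ω → ℝ)

/-- The optional σ-field `ℱ̄` on `Ω̄ = Ω × ℕ`. -/
def optionalSigma {m : MeasurableSpace Ω} (F : Filtration ℕ m) :
    MeasurableSpace (Ω × ℕ) :=
  MeasurableSpace.generateFrom
    {B | ∃ (t : ℕ) (A : Set Ω), MeasurableSet[F t] A ∧ B = A ×ˢ ({t} : Set ℕ)}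

/-- The optional filtration `ℱ̄_t` on `Ω̄ = Ω × ℕ`. -/
def optionalFiltration {m : MeasurableSpace Ω} (F : Filtration ℕ m) (t : ℕ) :
    MeasurableSpace (Ω × ℕ) :=
  MeasurableSpace.generateFrom
    ({B | ∃ (j : ℕ) (A : Set Ω), j < t ∧ MeasurableSet[F j] A ∧ B = A ×ˢ ({j} : Set ℕ)} ∪
      {B | ∃ A : Set Ω, MeasurableSet[F t] A ∧ B = A ×ˢ {s : ℕ | t ≤ s}})

/-- The risk measure `ρ̄_t` for random variables on `Ω̄` associated to a risk measure
`ρ_t` for processes:  `ρ̄_t(X)(ω,s) = −X_s(ω)` for `s < t` and `= ρ_t(π_t X)(ω)` for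
`s ≥ t`. -/
def rhoBar (t : ℕ) (ρ : (ℕ → Ω → ℝ) → Ω → ℝ) (Xb : Ω × ℕ → ℝ) : Ω × ℕ → ℝ :=
  fun p => if p.2 < t then -Xb p else ρ (projt t fun r ω => Xb (ω, r)) p.1

/-- The slice at `s` of a measurable set of `ℱ̄` is `ℱ_s`-measurable. -/
theorem measurable_slice_optionalSigma {m : MeasurableSpace Ω} (F : Filtration ℕ m) (s : ℕ) :
    Measurable[F s, optionalSigma F] fun ω : Ω => (ω, s) := by
  refine @measurable_generateFrom _ _ (F s) _ _ ?_
  rintro _ ⟨j, A, hA, rfl⟩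
  by_cases h : s = j
  · subst h
    convert hA using 1
    ext ω
    simp
  · convert @MeasurableSet.empty _ (F s) using 1
    ext ω
    simp [h]

/-- A subset of `Ω × ℕ` belongs to `ℱ̄` if all of its slices are measurable. -/
theorem measurableSet_optionalSigma {m : MeasurableSpace Ω} (F : Filtration ℕ m)
    {E : Set (Ω × ℕ)} (h : ∀ s, MeasurableSet[F s] {ω | (ω, s) ∈ E}) :
    MeasurableSet[optionalSigma F] E := by
  have hE : E = ⋃ s : ℕ, {ω | (ω, s) ∈ E} ×ˢ ({s} : Set ℕ) := by
    ext ⟨ω, s⟩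
    simp
  rw [hE]
  exact @MeasurableSet.iUnion _ _ (optionalSigma F) _ _ fun s =>
    MeasurableSpace.measurableSet_generateFrom ⟨s, _, h s, rfl⟩

/-- The slice at `s` of a measurable set of `ℱ̄_t` is measurable with respect to `ℱ_{min s t}`. -/
theorem measurable_slice_optionalFiltration {m : MeasurableSpace Ω} (F : Filtration ℕ m)
    (t s : ℕ) :
    Measurable[F (min s t), optionalFiltration F t] fun ω : Ω => (ω, s) := by
  refine @measurable_generateFrom _ _ (F (min s t)) _ _ ?_
  rintro _ (⟨j, A, hj, hA, rfl⟩ | ⟨A, hA, rfl⟩)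
  · by_cases h : s = j
    · subst h
      rw [min_eq_left hj.le]
      convert hA using 1
      ext ω
      simp
    · convert @MeasurableSet.empty _ (F (min s t)) using 1
      ext ω
      simp [h]
  · by_cases h : t ≤ s
    · rw [min_eq_right h]
      convert hA using 1
      ext ω
      simp [h]
    · convert @MeasurableSet.empty _ (F (min s t)) using 1
      ext ω
      simp [h]

/-- `ℱ̄_t` is a sub-`σ`-algebra of `ℱ̄`. -/
theorem optionalFiltration_le {m : MeasurableSpace Ω} (F : Filtration ℕ m) (t : ℕ) :
    optionalFiltration F t ≤ optionalSigma F := fun _ hE =>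
  measurableSet_optionalSigma F fun s =>
    F.mono (min_le_left s t) _ (measurable_slice_optionalFiltration F t s hE)

/-- `ℱ̄_t`-measurable functions are constant in time from `t` on. -/
theorem eq_of_measurable_optionalFiltration {m : MeasurableSpace Ω} {F : Filtration ℕ m} {t : ℕ}
    {f : Ω × ℕ → ℝ} (hf : Measurable[optionalFiltration F t] f) {s : ℕ} (hs : t ≤ s) (ω : Ω) :
    f (ω, s) = f (ω, t) := by
  have key : ∀ E, MeasurableSet[optionalFiltration F t] E → ((ω, s) ∈ E ↔ (ω, t) ∈ E) := by
    intro E hE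
    refine MeasurableSpace.generateFrom_induction _
      (fun B _ => ((ω, s) ∈ B ↔ (ω, t) ∈ B)) ?_ ?_ ?_ ?_ E hE
    · rintro _ (⟨j, A, hj, hA, rfl⟩ | ⟨A, hA, rfl⟩) _
      · have h1 : s ≠ j := by omega
        have h2 : t ≠ j := by omega
        simp [h1, h2]
      · simp [hs]
    · simp
    · intro E _ h
      simp [h]
    · intro E _ h
      simp [h]
  exact (key _ (hf (measurableSet_singleton (f (ω, t))))).2 rfl

/-- A function is `ℱ̄_t`-measurable if it is adapted before `t` and constant in time, with an
`ℱ_t`-measurable value, from `t` on. -/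
theorem measurable_optionalFiltration {m : MeasurableSpace Ω} (F : Filtration ℕ m) (t : ℕ)
    {f : Ω × ℕ → ℝ} {g : Ω → ℝ} (hf : ∀ j < t, Measurable[F j] fun ω => f (ω, j))
    (hg : Measurable[F t] g) (hfg : ∀ s, t ≤ s → ∀ ω, f (ω, s) = g ω) :
    Measurable[optionalFiltration F t] f := by
  intro B hB
  have hE : f ⁻¹' B = (⋃ j : ℕ, ⋃ _ : j < t, ((fun ω => f (ω, j)) ⁻¹' B) ×ˢ ({j} : Set ℕ)) ∪
      (g ⁻¹' B) ×ˢ {s : ℕ | t ≤ s} := by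
    ext ⟨ω, s⟩
    rcases lt_or_ge s t with h | h
    · simp [h]
    · simp [h, hfg s h, h.not_gt]
  rw [hE]
  refine @MeasurableSet.union _ (optionalFiltration F t) _ _ ?_ ?_
  · exact @MeasurableSet.iUnion _ _ (optionalFiltration F t) _ _ fun j =>
      @MeasurableSet.iUnion _ _ (optionalFiltration F t) _ _ fun hj =>
        MeasurableSpace.measurableSet_generateFrom (Or.inl ⟨j, _, hj, hf j hj hB, rfl⟩)
  · exact MeasurableSpace.measurableSet_generateFrom (Or.inr ⟨_, hg hB, rfl⟩)

/-- A measurable subset of `Ω × ℕ` is conull for `P̄` iff its slices are conull for `P`. -/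
theorem ae_optional_iff {m : MeasurableSpace Ω} {F : Filtration ℕ m}
    {P : Measure Ω} [IsProbabilityMeasure P] {μ : ℕ → Ω → ℝ}
    (hμ_meas : ∀ s, Measurable[F s] (μ s)) (hμ_pos : ∀ s, ∀ᵐ ω ∂P, 0 < μ s ω)
    (hμ_sum : ∀ᵐ ω ∂P, HasSum (fun s => μ s ω) 1)
    {Pbar : @Measure (Ω × ℕ) (optionalSigma F)} (hPbar_prob : IsProbabilityMeasure Pbar)
    (hPbar : ∀ X : Ω × ℕ → ℝ, Measurable[optionalSigma F] X →
      (∃ C : ℝ, ∀ p, |X p| ≤ C) →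
      ∫ p, X p ∂Pbar = ∫ ω, ∑' s, X (ω, s) * μ s ω ∂P)
    {Q : Ω × ℕ → Prop} (hQ : MeasurableSet[optionalSigma F] {p | Q p}) :
    (∀ᵐ p ∂Pbar, Q p) ↔ ∀ s, ∀ᵐ ω ∂P, Q (ω, s) := by
  have hind : ∀ E : Set (Ω × ℕ), MeasurableSet[optionalSigma F] E →
      Pbar.real E = ∫ ω, ∑' s, E.indicator 1 (ω, s) * μ s ω ∂P := by
    intro E hE
    have hmeas : Measurable[optionalSigma F] (E.indicator (1 : Ω × ℕ → ℝ)) := by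
      let := optionalSigma F
      exact Measurable.indicator (measurable_const (a := (1 : ℝ))) hE
    rw [← hPbar (E.indicator 1) hmeas ⟨1, fun p => ?_⟩, integral_indicator_one hE]
    by_cases hp : p ∈ E <;> simp [hp]
  have hQc : MeasurableSet[optionalSigma F] {p | ¬ Q p} := hQ.compl
  constructor
  · intro h s
    let A : Set Ω := {ω | ¬ Q (ω, s)}
    have hA : MeasurableSet[F s] A := measurable_slice_optionalSigma F s hQc
    have hE : MeasurableSet[optionalSigma F] (A ×ˢ ({s} : Set ℕ)) :=
      MeasurableSpace.measurableSet_generateFrom ⟨s, A, hA, rfl⟩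
    have hzero : Pbar (A ×ˢ ({s} : Set ℕ)) = 0 := by
      refine measure_mono_null ?_ (ae_iff.1 h)
      rintro ⟨ω, r⟩ ⟨h1, rfl⟩
      exact h1
    have hint := hind _ hE
    have hsum : ∀ ω, ∑' r, (A ×ˢ ({s} : Set ℕ)).indicator (1 : Ω × ℕ → ℝ) (ω, r) * μ r ω =
        A.indicator (μ s) ω := by
      intro ω
      rw [tsum_eq_single s]
      · by_cases hω : ω ∈ A <;> simp [hω]
      · intro r hr
        simp [hr]
    simp only [hsum, Measure.real, hzero, ENNReal.toReal_zero] at hint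
    have hnn : 0 ≤ᵐ[P] A.indicator (μ s) := by
      filter_upwards [hμ_pos s] with ω hω
      exact Set.indicator_apply_nonneg fun _ => hω.le
    have hmeas : Measurable (A.indicator (μ s)) :=
      ((hμ_meas s).mono (F.le s) le_rfl).indicator (F.le s _ hA)
    have hint' : Integrable (A.indicator (μ s)) P := by
      refine Integrable.of_bound hmeas.aestronglyMeasurable 1 ?_
      filter_upwards [ae_all_iff.2 hμ_pos, hμ_sum] with ω hpos hsum
      have hle : μ s ω ≤ 1 := le_hasSum hsum s fun r _ => (hpos r).le
      by_cases hω : ω ∈ A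
      · simpa [hω, abs_of_pos (hpos s)] using hle
      · simp [hω]
    filter_upwards [(integral_eq_zero_iff_of_nonneg_ae hnn hint').1 hint.symm, hμ_pos s]
      with ω h0 hpos
    by_contra hω
    have hωA : ω ∈ A := hω
    rw [Set.indicator_of_mem hωA] at h0
    exact hpos.ne' h0
  · intro h
    have hint := hind _ hQc
    rw [integral_eq_zero_of_ae] at hint
    · rw [ae_iff]
      exact (measureReal_eq_zero_iff (measure_ne_top _ _)).1 hint
    · filter_upwards [ae_all_iff.2 h] with ω hω
      simp [hω]

/-- The process obtained from an `ℱ̄`-measurable bounded function by killing it before `t`. -/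
theorem memRt_projt {m : MeasurableSpace Ω} (F : Filtration ℕ m) (t : ℕ) {Xb : Ω × ℕ → ℝ}
    (hX : Measurable[optionalSigma F] Xb) (hXb : ∃ C : ℝ, ∀ p, |Xb p| ≤ C) :
    MemRt F t (projt t fun r ω => Xb (ω, r)) := by
  obtain ⟨C, hC⟩ := hXb
  refine ⟨⟨fun s => ?_, C, fun s ω => ?_⟩, fun r hr ω => by simp [projt, hr.not_ge]⟩
  · by_cases h : t ≤ s
    · have heq : (projt t fun r ω => Xb (ω, r)) s = fun ω => Xb (ω, s) := by
        funext ω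
        simp [projt, h]
      rw [heq]
      exact hX.comp (measurable_slice_optionalSigma F s)
    · have heq : (projt t fun r ω => Xb (ω, r)) s = fun _ => 0 := by
        funext ω
        simp [projt, h]
      rw [heq]
      exact measurable_const
  · by_cases h : t ≤ s
    · simpa [projt, h] using hC (ω, s)
    · simpa [projt, h] using (abs_nonneg _).trans (hC (ω, s))

/-- `ρ̄_t` maps bounded `ℱ̄`-measurable functions to bounded `ℱ̄_t`-measurable functions. -/
theorem bddMeas_rhoBar {m : MeasurableSpace Ω} {F : Filtration ℕ m} {P : Measure Ω} {t : ℕ}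
    {ρ : (ℕ → Ω → ℝ) → Ω → ℝ} (hρ : IsCondRiskMeasure F P t ρ) {Xb : Ω × ℕ → ℝ}
    (hX : Measurable[optionalSigma F] Xb) (hXb : ∃ C : ℝ, ∀ p, |Xb p| ≤ C) :
    BddMeas (optionalFiltration F t) (rhoBar t ρ Xb) := by
  obtain ⟨hmeas, D, hD⟩ := hρ.map_into _ (memRt_projt F t hX hXb)
  obtain ⟨C, hC⟩ := hXb
  refine ⟨measurable_optionalFiltration F t (fun j hj => ?_) hmeas fun s hs ω => ?_,
    max C D, fun p => ?_⟩
  · simp only [rhoBar, hj, if_true]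
    exact (hX.comp (measurable_slice_optionalSigma F j)).neg
  · simp [rhoBar, hs.not_gt]
  · by_cases h : p.2 < t
    · simpa [rhoBar, h] using Or.inl (hC p)
    · simpa [rhoBar, h] using Or.inr (hD p.1)

/-- **From risk measures for processes to risk measures for random variables on the
optional σ-field.**  If `ρ_t` is a conditional convex risk measure for processes, then
`ρ̄_t` maps bounded `ℱ̄`-measurable functions to bounded `ℱ̄_t`-measurable functions and is
a conditional convex risk measure for random variables with respect to `(ℱ̄_t, P̄)`. -/
theorem stmt_3 {m : MeasurableSpace Ω} (F : Filtration ℕ m)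
    (P : Measure Ω) [IsProbabilityMeasure P]
    (hF0 : ∀ A : Set Ω, MeasurableSet[F 0] A → P A = 0 ∨ P A = 1)
    (μ : ℕ → Ω → ℝ)
    (hμ_meas : ∀ s, Measurable[F s] (μ s))
    (hμ_pos : ∀ s, ∀ᵐ ω ∂P, 0 < μ s ω)
    (hμ_sum : ∀ᵐ ω ∂P, HasSum (fun s => μ s ω) 1)
    (Pbar : @Measure (Ω × ℕ) (optionalSigma F))
    (hPbar_prob : IsProbabilityMeasure Pbar)
    (hPbar : ∀ X : Ω × ℕ → ℝ, Measurable[optionalSigma F] X →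
      (∃ C : ℝ, ∀ p, |X p| ≤ C) →
      ∫ p, X p ∂Pbar = ∫ ω, ∑' s, X (ω, s) * μ s ω ∂P)
    (t : ℕ) (ρ : (ℕ → Ω → ℝ) → Ω → ℝ)
    (hρ : IsCondRiskMeasure F P t ρ) :
    -- `ρ̄_t` maps bounded `ℱ̄`-measurable functions to bounded `ℱ̄_t`-measurable functions
    (∀ Xb : Ω × ℕ → ℝ, Measurable[optionalSigma F] Xb → (∃ C : ℝ, ∀ p, |Xb p| ≤ C) →
      BddMeas (optionalFiltration F t) (rhoBar t ρ Xb)) ∧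
    -- conditional cash invariance
    (∀ Xb : Ω × ℕ → ℝ, Measurable[optionalSigma F] Xb → (∃ C : ℝ, ∀ p, |Xb p| ≤ C) →
      ∀ mb : Ω × ℕ → ℝ, BddMeas (optionalFiltration F t) mb →
        rhoBar t ρ (fun p => Xb p + mb p) =ᵐ[Pbar] fun p => rhoBar t ρ Xb p - mb p) ∧
    -- monotonicity
    (∀ Xb Yb : Ω × ℕ → ℝ, Measurable[optionalSigma F] Xb → (∃ C : ℝ, ∀ p, |Xb p| ≤ C) →
      Measurable[optionalSigma F] Yb → (∃ C : ℝ, ∀ p, |Yb p| ≤ C) →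
      (∀ᵐ p ∂Pbar, Xb p ≤ Yb p) →
      ∀ᵐ p ∂Pbar, rhoBar t ρ Yb p ≤ rhoBar t ρ Xb p) ∧
    -- conditional convexity
    (∀ Xb Yb : Ω × ℕ → ℝ, Measurable[optionalSigma F] Xb → (∃ C : ℝ, ∀ p, |Xb p| ≤ C) →
      Measurable[optionalSigma F] Yb → (∃ C : ℝ, ∀ p, |Yb p| ≤ C) →
      ∀ lam : Ω × ℕ → ℝ, Measurable[optionalFiltration F t] lam →
        (∀ p, 0 ≤ lam p ∧ lam p ≤ 1) →
        ∀ᵐ p ∂Pbar,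
          rhoBar t ρ (fun q => lam q * Xb q + (1 - lam q) * Yb q) p ≤
            lam p * rhoBar t ρ Xb p + (1 - lam p) * rhoBar t ρ Yb p) ∧
    -- normalization
    rhoBar t ρ (fun _ => 0) =ᵐ[Pbar] (0 : Ω × ℕ → ℝ) := by
  have hlift : ∀ {Q : Ω × ℕ → Prop}, MeasurableSet[optionalSigma F] {p | Q p} →
      ((∀ᵐ p ∂Pbar, Q p) ↔ ∀ s, ∀ᵐ ω ∂P, Q (ω, s)) := fun hQ =>
    ae_optional_iff hμ_meas hμ_pos hμ_sum hPbar_prob hPbar hQ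
  have hle := optionalFiltration_le F t
  have hmeas : ∀ {Xb : Ω × ℕ → ℝ}, Measurable[optionalSigma F] Xb →
      (∃ C : ℝ, ∀ p, |Xb p| ≤ C) → Measurable[optionalSigma F] (rhoBar t ρ Xb) :=
    fun hX hXb => (bddMeas_rhoBar hρ hX hXb).1.mono hle le_rfl
  have hslice : ∀ {f : Ω × ℕ → ℝ}, Measurable[optionalFiltration F t] f →
      Measurable[F t] fun ω => f (ω, t) := by
    intro f hf
    have := hf.comp (measurable_slice_optionalFiltration F t t)
    rwa [min_self] at this
  refine ⟨fun Xb hX hXb => bddMeas_rhoBar hρ hX hXb, ?_, ?_, ?_, ?_⟩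
  · intro Xb hX hXb mb ⟨hm, D, hD⟩
    have hm' : Measurable[optionalSigma F] mb := hm.mono hle le_rfl
    have hbdd : ∃ C : ℝ, ∀ p, |Xb p + mb p| ≤ C := by
      obtain ⟨C, hC⟩ := hXb
      exact ⟨C + D, fun p => (abs_add_le _ _).trans (add_le_add (hC p) (hD p))⟩
    refine (hlift (Q := fun p => rhoBar t ρ (fun p => Xb p + mb p) p = rhoBar t ρ Xb p - mb p)
      (measurableSet_eq_fun (hmeas (hX.add hm') hbdd)
      ((hmeas hX hXb).sub hm'))).2 fun s => ?_
    by_cases hs : s < t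
    · refine ae_of_all _ fun ω => ?_
      simp only [rhoBar, hs, if_true]
      ring
    · have heq : (projt t fun r ω => Xb (ω, r) + mb (ω, r)) = fun r ω =>
          projt t (fun r ω => Xb (ω, r)) r ω + if t ≤ r then mb (ω, t) else 0 := by
        funext r ω
        by_cases hr : t ≤ r
        · simp [projt, hr, eq_of_measurable_optionalFiltration hm hr ω]
        · simp [projt, hr]
      filter_upwards [hρ.cash _ (memRt_projt F t hX hXb) (fun ω => mb (ω, t))
        ⟨hslice hm, D, fun ω => hD _⟩] with ω hω
      simp only [rhoBar, hs, if_false, heq, hω,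
        eq_of_measurable_optionalFiltration hm (not_lt.1 hs) ω]
  · intro Xb Yb hX hXb hY hYb hXY
    have hXY' := (hlift (measurableSet_le hX hY)).1 hXY
    refine (hlift (measurableSet_le (hmeas hY hYb) (hmeas hX hXb))).2 fun s => ?_
    by_cases hs : s < t
    · filter_upwards [hXY' s] with ω hω
      simpa [rhoBar, hs] using hω
    · have hmono := hρ.mono _ _ (memRt_projt F t hX hXb) (memRt_projt F t hY hYb) fun r => by
        filter_upwards [hXY' r] with ω hω
        by_cases hr : t ≤ r
        · simpa [projt, hr] using hω
        · simp [projt, hr]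
      filter_upwards [hmono] with ω hω
      simpa only [rhoBar, hs, if_false] using hω
  · intro Xb Yb hX hXb hY hYb lam hl hl01
    have hl' : Measurable[optionalSigma F] lam := hl.mono hle le_rfl
    have hone : Measurable[optionalSigma F] fun p => 1 - lam p := measurable_const.sub hl'
    have hbdd : ∃ C : ℝ, ∀ p, |lam p * Xb p + (1 - lam p) * Yb p| ≤ C := by
      obtain ⟨C, hC⟩ := hXb
      obtain ⟨D, hD⟩ := hYb
      refine ⟨C + D, fun p => (abs_add_le _ _).trans (add_le_add ?_ ?_)⟩
      · rw [abs_mul, abs_of_nonneg (hl01 p).1]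
        exact (mul_le_of_le_one_left (abs_nonneg _) (hl01 p).2).trans (hC p)
      · rw [abs_mul, abs_of_nonneg (sub_nonneg.2 (hl01 p).2)]
        exact (mul_le_of_le_one_left (abs_nonneg _) (sub_le_self _ (hl01 p).1)).trans (hD p)
    refine (hlift (Q := fun p =>
      rhoBar t ρ (fun q => lam q * Xb q + (1 - lam q) * Yb q) p ≤
        lam p * rhoBar t ρ Xb p + (1 - lam p) * rhoBar t ρ Yb p)
      (measurableSet_le (hmeas ((hl'.mul hX).add (hone.mul hY)) hbdd)
      ((hl'.mul (hmeas hX hXb)).add (hone.mul (hmeas hY hYb))))).2 fun s => ?_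
    by_cases hs : s < t
    · refine ae_of_all _ fun ω => le_of_eq ?_
      simp only [rhoBar, hs, if_true]
      ring
    · have heq : (projt t fun r ω => lam (ω, r) * Xb (ω, r) + (1 - lam (ω, r)) * Yb (ω, r)) =
          fun r ω => lam (ω, t) * projt t (fun r ω => Xb (ω, r)) r ω +
            (1 - lam (ω, t)) * projt t (fun r ω => Yb (ω, r)) r ω := by
        funext r ω
        by_cases hr : t ≤ r
        · simp [projt, hr, eq_of_measurable_optionalFiltration hl hr ω]
        · simp [projt, hr]
      filter_upwards [hρ.convex _ _ (memRt_projt F t hX hXb) (memRt_projt F t hY hYb)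
        (fun ω => lam (ω, t)) (hslice hl) fun ω => hl01 _] with ω hω
      simpa only [rhoBar, hs, if_false, heq,
        eq_of_measurable_optionalFiltration hl (not_lt.1 hs) ω] using hω
  · have h0 : ∃ C : ℝ, ∀ p : Ω × ℕ, |(fun _ => (0 : ℝ)) p| ≤ C := ⟨0, by simp⟩
    refine (hlift (Q := fun p => rhoBar t ρ (fun _ => 0) p = 0)
      (measurableSet_eq_fun (hmeas measurable_const h0) measurable_const)).2
      fun s => ?_
    by_cases hs : s < t
    · exact ae_of_all _ fun ω => by simp [rhoBar, hs]
    · have heq : (projt t fun (_ : ℕ) (_ : Ω) => (0 : ℝ)) = fun _ _ => 0 := by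
        funext r ω
        simp [projt]
      filter_upwards [hρ.norm] with ω hω
      simpa only [rhoBar, hs, if_false, heq, Pi.zero_apply] using hω
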